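/- Let α be a continuous action of a countable sofic group G on a compact metrizable space X, let Σ be a sofic approximation sequence for G, let ρ be a compatible metric on X, and let f : X → ℝ be continuous. Then P_{Σ,∞}(f,X,G,ρ) ≤ sup { h_{Σ,μ,∞}(ρ) + ∫_X f dμ : μ ∈ M_G(X) } (where the supremum of the empty set is −∞). -/

import Mathlib

open Filter MeasureTheory
open scoped Pointwise Classical BigOperators

namespace Sofic

structure ContAction (G : Type*) [Group G] (X : Type*) [TopologicalSpace X]
    (α : G → X → X) : Prop where
  one : ∀ x, α 1 x = x
  mul : ∀ s t x, α (s * t) x = α s (α t x)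
  cont : ∀ s, Continuous (α s)

structure IsContPseudoMetric (X : Type*) [TopologicalSpace X] (ρ : X → X → ℝ) : Prop where
  nonneg : ∀ x y, 0 ≤ ρ x y
  refl : ∀ x, ρ x x = 0
  symm : ∀ x y, ρ x y = ρ y x
  triangle : ∀ x y z, ρ x z ≤ ρ x y + ρ y z
  cont : Continuous fun p : X × X => ρ p.1 p.2

structure IsCompatMetric (X : Type*) [TopologicalSpace X] (ρ : X → X → ℝ)
    extends IsContPseudoMetric X ρ : Prop where
  eq_of_zero : ∀ x y, ρ x y = 0 → x = y
  ball_mem : ∀ x : X, ∀ U ∈ nhds x, ∃ ε > 0, {y | ρ x y < ε} ⊆ U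

structure IsSoficApprox (G : Type*) [Group G] (d : ℕ → ℕ)
    (σ : ∀ i, G → Equiv.Perm (Fin (d i))) : Prop where
  mul : ∀ s t : G, Tendsto
    (fun i => ((Finset.univ.filter fun a : Fin (d i) => σ i s (σ i t a) = σ i (s * t) a).card : ℝ) / (d i : ℝ))
    atTop (nhds 1)
  sep : ∀ s t : G, s ≠ t → Tendsto
    (fun i => ((Finset.univ.filter fun a : Fin (d i) => σ i s a ≠ σ i t a).card : ℝ) / (d i : ℝ))
    atTop (nhds 1)
  dim_top : Tendsto d atTop atTop

noncomputable def rho2 {X : Type*} (ρ : X → X → ℝ) {d : ℕ} (φ ψ : Fin d → X) : ℝ :=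
  Real.sqrt ((1 / (d : ℝ)) * ∑ a, (ρ (φ a) (ψ a)) ^ 2)

noncomputable def rhoInf {X : Type*} (ρ : X → X → ℝ) {d : ℕ} (φ ψ : Fin d → X) : ℝ :=
  ⨆ a : Fin d, ρ (φ a) (ψ a)

def MapSet {G X : Type*} [Group G] (α : G → X → X) (ρ : X → X → ℝ)
    (F : Finset G) (δ : ℝ) {d : ℕ} (σ : G → Equiv.Perm (Fin d)) : Set (Fin d → X) :=
  {φ | ∀ s ∈ F, rho2 ρ (fun a => α s (φ a)) (fun a => φ (σ s a)) < δ}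

noncomputable def Mval {G X : Type*} [Group G] (α : G → X → X) (f : X → ℝ) (ρ : X → X → ℝ)
    (ε : ℝ) (F : Finset G) (δ : ℝ) {d : ℕ} (σ : G → Equiv.Perm (Fin d))
    (sepd : (Fin d → X) → (Fin d → X) → ℝ) : ℝ :=
  sSup {r : ℝ | ∃ E : Finset (Fin d → X), ↑E ⊆ MapSet α ρ F δ σ ∧
    (∀ φ ∈ E, ∀ ψ ∈ E, φ ≠ ψ → ε ≤ sepd φ ψ) ∧
    r = ∑ φ ∈ E, Real.exp (∑ a, f (φ a))}

noncomputable def PressureInf {G X : Type*} [Group G] (α : G → X → X) (f : X → ℝ)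
    (ρ : X → X → ℝ) (d : ℕ → ℕ) (σ : ∀ i, G → Equiv.Perm (Fin (d i))) : EReal :=
  ⨆ (ε : ℝ) (_ : 0 < ε), ⨅ (F : Finset G) (_ : F.Nonempty), ⨅ (δ : ℝ) (_ : 0 < δ),
    Filter.limsup (fun i =>
      if (MapSet α ρ F δ (σ i)).Nonempty then
        (((Real.log (Mval α f ρ ε F δ (σ i) (rhoInf ρ))) / (d i : ℝ) : ℝ) : EReal)
      else (⊥ : EReal)) atTop

noncomputable def Pressure2 {G X : Type*} [Group G] (α : G → X → X) (f : X → ℝ)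
    (ρ : X → X → ℝ) (d : ℕ → ℕ) (σ : ∀ i, G → Equiv.Perm (Fin (d i))) : EReal :=
  ⨆ (ε : ℝ) (_ : 0 < ε), ⨅ (F : Finset G) (_ : F.Nonempty), ⨅ (δ : ℝ) (_ : 0 < δ),
    Filter.limsup (fun i =>
      if (MapSet α ρ F δ (σ i)).Nonempty then
        (((Real.log (Mval α f ρ ε F δ (σ i) (rho2 ρ))) / (d i : ℝ) : ℝ) : EReal)
      else (⊥ : EReal)) atTop

def MapMuSet {G X : Type*} [Group G] [TopologicalSpace X] [MeasurableSpace X]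
    (α : G → X → X) (μ : Measure X) (ρ : X → X → ℝ) (F : Finset G)
    (L : Finset C(X, ℝ)) (δ : ℝ) {d : ℕ} (σ : G → Equiv.Perm (Fin d)) : Set (Fin d → X) :=
  {φ | φ ∈ MapSet α ρ F δ σ ∧
    ∀ g ∈ L, |(1 / (d : ℝ)) * ∑ j, g (φ j) - ∫ x, g x ∂μ| < δ}

noncomputable def Nval {X : Type*} (ε : ℝ) {d : ℕ} (Y : Set (Fin d → X))
    (sepd : (Fin d → X) → (Fin d → X) → ℝ) : ℝ :=
  sSup {r : ℝ | ∃ E : Finset (Fin d → X), ↑E ⊆ Y ∧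
    (∀ φ ∈ E, ∀ ψ ∈ E, φ ≠ ψ → ε ≤ sepd φ ψ) ∧ r = (E.card : ℝ)}

noncomputable def MeasEntropy {G X : Type*} [Group G] [TopologicalSpace X] [MeasurableSpace X]
    (α : G → X → X) (μ : Measure X) (ρ : X → X → ℝ) (d : ℕ → ℕ)
    (σ : ∀ i, G → Equiv.Perm (Fin (d i))) : EReal :=
  ⨆ (ε : ℝ) (_ : 0 < ε), ⨅ (F : Finset G) (_ : F.Nonempty),
    ⨅ (L : Finset C(X, ℝ)) (_ : L.Nonempty), ⨅ (δ : ℝ) (_ : 0 < δ),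
      Filter.limsup (fun i =>
        if (MapMuSet α μ ρ F L δ (σ i)).Nonempty then
          (((Real.log (Nval ε (MapMuSet α μ ρ F L δ (σ i)) (rhoInf ρ))) / (d i : ℝ) : ℝ) : EReal)
        else (⊥ : EReal)) atTop

def IsInvProb {G X : Type*} [Group G] [MeasurableSpace X]
    (α : G → X → X) (μ : Measure X) : Prop :=
  IsProbabilityMeasure μ ∧ ∀ s : G, Measure.map (α s) μ = μ

noncomputable def Kval {G X : Type*} [Group G] (α : G → X → X) (f : X → ℝ)
    (ρ : X → X → ℝ) (ε : ℝ) (F : Finset G) : ℝ :=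
  sSup {r : ℝ | ∃ D : Finset X,
    (∀ x ∈ D, ∀ y ∈ D, x ≠ y → ε ≤ ⨆ s ∈ F, ρ (α s x) (α s y)) ∧
    r = ∑ x ∈ D, Real.exp (∑ s ∈ F, f (α s x))}

def IsFolnerSeq (G : Type*) [Group G] [DecidableEq G] (Fol : ℕ → Finset G) : Prop :=
  (∀ n, (Fol n).Nonempty) ∧ ∀ s : G,
    Tendsto (fun n =>
      (((((Fol n).image fun t => s * t) \ Fol n) ∪ (Fol n \ ((Fol n).image fun t => s * t))).card : ℝ)
        / ((Fol n).card : ℝ)) atTop (nhds 0)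

section Pressure

variable {G X : Type*} [Group G]

theorem MapSet.mono {α : G → X → X} {ρ : X → X → ℝ} {F F' : Finset G} {δ δ' : ℝ} {d : ℕ}
    {σ : G → Equiv.Perm (Fin d)} (hF : F' ⊆ F) (hδ : δ ≤ δ') :
    MapSet α ρ F δ σ ⊆ MapSet α ρ F' δ' σ :=
  fun _ hφ s hs => (hφ s (hF hs)).trans_le hδ

section Topology

variable [TopologicalSpace X]

theorem MapMuSet.mono [MeasurableSpace X] {α : G → X → X} {μ : Measure X} {ρ : X → X → ℝ}
    {F F' : Finset G} {L L' : Finset C(X, ℝ)} {δ δ' : ℝ} {d : ℕ} {σ : G → Equiv.Perm (Fin d)}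
    (hF : F' ⊆ F) (hL : L' ⊆ L) (hδ : δ ≤ δ') :
    MapMuSet α μ ρ F L δ σ ⊆ MapMuSet α μ ρ F' L' δ' σ :=
  fun _ hφ => ⟨MapSet.mono hF hδ hφ.1, fun g hg => (hφ.2 g (hL hg)).trans_le hδ⟩

variable [CompactSpace X]

theorem IsCompatMetric.abs_sub_le_add_mul_sq {ρ : X → X → ℝ} (hρ : IsCompatMetric X ρ)
    (g : C(X, ℝ)) {η : ℝ} (hη : 0 < η) :
    ∃ C, 0 ≤ C ∧ ∀ x y, |g x - g y| ≤ η + C * ρ x y ^ 2 := by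
  have hbound : ∀ x y, |g x - g y| ≤ 2 * ‖g‖ := fun x y => by
    simpa [Real.dist_eq] using g.dist_le_two_norm x y
  have hK : IsCompact {p : X × X | η ≤ |g p.1 - g p.2|} :=
    (isClosed_le continuous_const (by fun_prop)).isCompact
  rcases Set.eq_empty_or_nonempty {p : X × X | η ≤ |g p.1 - g p.2|} with hempty | hne
  · refine ⟨0, le_rfl, fun x y => ?_⟩
    have : (x, y) ∉ {p : X × X | η ≤ |g p.1 - g p.2|} := by rw [hempty]; simp
    simp only [Set.mem_ofPred_eq, not_le] at this
    linarith
  obtain ⟨p, hp, hmin⟩ := hK.exists_isMinOn hne hρ.cont.continuousOn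
  have hpos : 0 < ρ p.1 p.2 := by
    refine (hρ.nonneg _ _).lt_of_ne fun h => ?_
    have heq := hρ.eq_of_zero _ _ h.symm
    simp only [Set.mem_ofPred_eq, heq, sub_self, abs_zero] at hp
    linarith
  refine ⟨2 * ‖g‖ / ρ p.1 p.2 ^ 2, by positivity, fun x y => ?_⟩
  rcases lt_or_ge |g x - g y| η with h | h
  · have : 0 ≤ 2 * ‖g‖ / ρ p.1 p.2 ^ 2 * ρ x y ^ 2 := by positivity
    linarith
  · have hle : ρ p.1 p.2 ≤ ρ x y := hmin (show (x, y) ∈ {p : X × X | η ≤ |g p.1 - g p.2|} from h)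
    have h1 : 2 * ‖g‖ ≤ 2 * ‖g‖ / ρ p.1 p.2 ^ 2 * ρ x y ^ 2 := by
      rw [div_mul_eq_mul_div, le_div_iff₀ (by positivity)]
      gcongr
    linarith [hbound x y]

theorem IsCompatMetric.exists_card_le_pow {ρ : X → X → ℝ} (hρ : IsCompatMetric X ρ)
    {ε : ℝ} (hε : 0 < ε) :
    ∃ n : ℕ, ∀ (d : ℕ) (E : Finset (Fin d → X)),
      (∀ φ ∈ E, ∀ ψ ∈ E, φ ≠ ψ → ε ≤ rhoInf ρ φ ψ) → E.card ≤ n ^ d := by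
  have hopen : ∀ x, IsOpen {y | ρ x y < ε / 3} := fun x =>
    isOpen_lt (hρ.cont.comp (by fun_prop : Continuous fun y => (x, y))) continuous_const
  obtain ⟨t, ht⟩ := CompactSpace.elim_nhds_subcover (fun x => {y | ρ x y < ε / 3}) fun x =>
    (hopen x).mem_nhds (by simp only [Set.mem_ofPred_eq, hρ.refl]; positivity)
  have hcell : ∀ y, ∃ x : t, ρ x y < ε / 3 := fun y => by
    have hy : y ∈ ⋃ x ∈ t, {y | ρ x y < ε / 3} := by rw [ht]; trivial
    simp only [Set.mem_iUnion, Set.mem_ofPred_eq] at hy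
    obtain ⟨x, hx, hxy⟩ := hy
    exact ⟨⟨x, hx⟩, hxy⟩
  choose c hc using hcell
  refine ⟨t.card, fun d E hE => ?_⟩
  have hinj : Set.InjOn (fun (φ : Fin d → X) a => c (φ a)) E := by
    intro φ hφ ψ hψ h
    by_contra hne
    have hle : rhoInf ρ φ ψ ≤ 2 * (ε / 3) := by
      refine Real.iSup_le (fun a => ?_) (by positivity)
      have h1 := hc (φ a)
      have h2 := hc (ψ a)
      rw [← show c (φ a) = c (ψ a) from congrFun h a] at h2
      have h3 := hρ.triangle (φ a) (c (φ a)) (ψ a)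
      rw [hρ.symm (φ a) (c (φ a))] at h3
      linarith
    linarith [hE φ hφ ψ hψ hne]
  have := Finset.card_le_card_of_injOn (t := Finset.univ) _ (fun _ _ => Finset.mem_univ _) hinj
  simpa using this

theorem IsCompatMetric.abs_average_comp_sub_average_lt {ρ : X → X → ℝ} (hρ : IsCompatMetric X ρ)
    (α : G → X → X) (s : G) (g : C(X, ℝ)) {η : ℝ} (hη : 0 < η) :
    ∃ δ > 0, ∀ (d : ℕ), 0 < d → ∀ (σ : G → Equiv.Perm (Fin d)), ∀ φ ∈ MapSet α ρ {s} δ σ,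
      |(1 / (d : ℝ)) * ∑ a, g (α s (φ a)) - (1 / (d : ℝ)) * ∑ a, g (φ a)| < η := by
  obtain ⟨C, hC, hg⟩ := hρ.abs_sub_le_add_mul_sq g (half_pos hη)
  refine ⟨Real.sqrt (η / (2 * (C + 1))), by positivity, fun d hd σ φ hφ => ?_⟩
  have hd' : (0 : ℝ) < d := by exact_mod_cast hd
  have hlt := hφ s (Finset.mem_singleton_self s)
  rw [rho2, Real.sqrt_lt_sqrt_iff (by positivity)] at hlt
  set S := ∑ a, ρ (α s (φ a)) (φ (σ s a)) ^ 2 with hS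
  have hperm : ∑ a, g (φ a) = ∑ a, g (φ (σ s a)) :=
    (Equiv.sum_comp (σ s) fun a => g (φ a)).symm
  have hsum : |∑ a, (g (α s (φ a)) - g (φ (σ s a)))| ≤ d * (η / 2) + C * S := by
    calc _ ≤ ∑ a, |g (α s (φ a)) - g (φ (σ s a))| := Finset.abs_sum_le_sum_abs _ _
      _ ≤ ∑ a, (η / 2 + C * ρ (α s (φ a)) (φ (σ s a)) ^ 2) :=
        Finset.sum_le_sum fun a _ => hg _ _
      _ = _ := by simp [Finset.sum_add_distrib, Finset.mul_sum, hS]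
  rw [← mul_sub, hperm, ← Finset.sum_sub_distrib, abs_mul, abs_of_pos (by positivity)]
  calc _ ≤ 1 / (d : ℝ) * (d * (η / 2) + C * S) := by gcongr
    _ = η / 2 + C * (1 / d * S) := by field_simp
    _ ≤ η / 2 + C * (η / (2 * (C + 1))) := by gcongr
    _ < η := by
      have : C * (η / (2 * (C + 1))) = η / 2 * (C / (C + 1)) := by field_simp
      have h1 : C / (C + 1) < 1 := by rw [div_lt_one (by positivity)]; linarith
      nlinarith

end Topology

section Empirical

variable [MeasurableSpace X]

/-- The uniform probability measure on the values of `φ`, counted with multiplicity. -/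
noncomputable def empiricalMeasure {d : ℕ} (φ : Fin d → X) : Measure X :=
  (d : ENNReal)⁻¹ • ∑ a, Measure.dirac (φ a)

theorem isProbabilityMeasure_empiricalMeasure {d : ℕ} (hd : 0 < d) (φ : Fin d → X) :
    IsProbabilityMeasure (empiricalMeasure φ) := by
  constructor
  simp only [empiricalMeasure, Measure.smul_apply, Measure.coe_finsetSum, Finset.sum_apply,
    measure_univ, Finset.sum_const, Finset.card_univ, Fintype.card_fin, smul_eq_mul, nsmul_eq_mul,
    mul_one]
  exact ENNReal.inv_mul_cancel (by exact_mod_cast hd.ne') (ENNReal.natCast_ne_top d)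

theorem integral_empiricalMeasure [TopologicalSpace X] [CompactSpace X] [BorelSpace X] {d : ℕ}
    (φ : Fin d → X) (g : C(X, ℝ)) :
    ∫ x, g x ∂(empiricalMeasure φ) = (1 / (d : ℝ)) * ∑ a, g (φ a) := by
  have hm : StronglyMeasurable g := g.continuous.stronglyMeasurable_of_hasCompactSupport
    (HasCompactSupport.of_compactSpace _)
  have hi : ∀ a ∈ Finset.univ, Integrable g (Measure.dirac (φ a)) := fun a _ =>
    g.continuous.integrable_of_hasCompactSupport (HasCompactSupport.of_compactSpace _)
  rw [empiricalMeasure, integral_smul_measure, integral_finsetSum_measure hi]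
  simp [integral_dirac' _ _ hm]

end Empirical

theorem exists_card_le_exp_of_measEntropy_lt [TopologicalSpace X] [CompactSpace X]
    [MeasurableSpace X] {α : G → X → X} {ρ : X → X → ℝ} (hρ : IsCompatMetric X ρ)
    (μ : Measure X) {d : ℕ → ℕ} {σ : ∀ i, G → Equiv.Perm (Fin (d i))}
    (hd : Tendsto d atTop atTop) {b : ℝ} (h : MeasEntropy α μ ρ d σ < b) {ε : ℝ} (hε : 0 < ε) :
    ∃ (F : Finset G) (L : Finset C(X, ℝ)) (δ : ℝ), 0 < δ ∧
      ∀ᶠ i in atTop, ∀ E : Finset (Fin (d i) → X), ↑E ⊆ MapMuSet α μ ρ F L δ (σ i) →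
        (∀ φ ∈ E, ∀ ψ ∈ E, φ ≠ ψ → ε ≤ rhoInf ρ φ ψ) → (E.card : ℝ) ≤ Real.exp (d i * b) := by
  have h1 := (le_iSup₂ (f := fun (ε : ℝ) (_ : 0 < ε) => ⨅ (F : Finset G) (_ : F.Nonempty),
    ⨅ (L : Finset C(X, ℝ)) (_ : L.Nonempty), ⨅ (δ : ℝ) (_ : 0 < δ),
      Filter.limsup (fun i =>
        if (MapMuSet α μ ρ F L δ (σ i)).Nonempty then
          (((Real.log (Nval ε (MapMuSet α μ ρ F L δ (σ i)) (rhoInf ρ))) / (d i : ℝ) : ℝ) : EReal)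
        else (⊥ : EReal)) atTop) ε hε).trans_lt h
  simp only [iInf_lt_iff] at h1
  obtain ⟨F, -, L, -, δ, hδ, h1⟩ := h1
  obtain ⟨n, hn⟩ := hρ.exists_card_le_pow hε
  refine ⟨F, L, δ, hδ, ?_⟩
  filter_upwards [eventually_lt_of_limsup_lt h1, hd.eventually_gt_atTop 0] with i hi hdi E hE hsep
  rcases E.eq_empty_or_nonempty with rfl | ⟨φ, hφ⟩
  · simpa using (Real.exp_pos _).le
  rw [if_pos ⟨φ, hE hφ⟩, EReal.coe_lt_coe_iff, div_lt_iff₀ (by exact_mod_cast hdi)] at hi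
  have hle : (E.card : ℝ) ≤ Nval ε (MapMuSet α μ ρ F L δ (σ i)) (rhoInf ρ) := by
    refine le_csSup ⟨(n : ℝ) ^ d i, ?_⟩ ⟨E, hE, hsep, rfl⟩
    rintro r ⟨E', -, hE', rfl⟩
    exact_mod_cast hn _ E' hE'
  have hpos : (0 : ℝ) < E.card := by exact_mod_cast Finset.card_pos.2 ⟨φ, hφ⟩
  rw [mul_comm b] at hi
  exact hle.trans ((Real.log_le_iff_le_exp (hpos.trans_le hle)).1 hi.le)

theorem sum_exp_le_exp_of_card_le [TopologicalSpace X] [MeasurableSpace X]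
    {α : G → X → X} {ρ : X → X → ℝ} (f : C(X, ℝ)) {μ : Measure X}
    {F : Finset G} {L : Finset C(X, ℝ)} {δ c : ℝ} {d : ℕ} (hd : 0 < d)
    {σ : G → Equiv.Perm (Fin d)} (hf : f ∈ L) {E : Finset (Fin d → X)}
    (hE : ↑E ⊆ MapMuSet α μ ρ F L δ σ)
    (hcard : (E.card : ℝ) ≤ Real.exp (d * (c - ∫ x, f x ∂μ - δ))) :
    ∑ φ ∈ E, Real.exp (∑ a, f (φ a)) ≤ Real.exp (d * c) := by
  have hd' : (0 : ℝ) < d := by exact_mod_cast hd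
  calc _ ≤ ∑ φ ∈ E, Real.exp (d * (∫ x, f x ∂μ + δ)) := by
        refine Finset.sum_le_sum fun φ hφ => Real.exp_le_exp.2 ?_
        have := (abs_lt.1 ((hE hφ).2 f hf)).2
        rw [sub_lt_iff_lt_add', one_div, inv_mul_lt_iff₀ hd'] at this
        exact this.le
    _ = E.card * Real.exp (d * (∫ x, f x ∂μ + δ)) := by simp
    _ ≤ Real.exp (d * (c - ∫ x, f x ∂μ - δ)) * Real.exp (d * (∫ x, f x ∂μ + δ)) := by gcongr
    _ = Real.exp (d * c) := by rw [← Real.exp_add]; ring_nf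

theorem sum_biUnion_le_sum_sum {ι κ : Type*} [DecidableEq κ] (t : Finset ι) (P : ι → Finset κ)
    {w : κ → ℝ} (hw : ∀ k, 0 ≤ w k) : ∑ k ∈ t.biUnion P, w k ≤ ∑ j ∈ t, ∑ k ∈ P j, w k := by
  induction t using Finset.induction_on with
  | empty => simp
  | insert j t hj ih =>
    rw [Finset.biUnion_insert, Finset.sum_insert hj]
    have h1 := Finset.sum_union_inter (s₁ := P j) (s₂ := t.biUnion P) (f := w)
    have h2 : 0 ≤ ∑ k ∈ P j ∩ t.biUnion P, w k := Finset.sum_nonneg fun k _ => hw k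
    linarith

section Measure

variable [TopologicalSpace X] [CompactSpace X] [TopologicalSpace.MetrizableSpace X]
  [MeasurableSpace X] [BorelSpace X] {α : G → X → X} {ρ : X → X → ℝ}

/-- If `μ` is not invariant, then no map into `X` is both approximately equivariant and
approximately distributed according to `μ`. -/
theorem exists_mapMuSet_eq_empty (hα : ContAction G X α) (hρ : IsCompatMetric X ρ)
    (μ : Measure X) [IsProbabilityMeasure μ] (hμ : ¬ IsInvProb α μ) :
    ∃ (F : Finset G) (L : Finset C(X, ℝ)) (δ : ℝ), 0 < δ ∧
      ∀ (d : ℕ), 0 < d → ∀ σ : G → Equiv.Perm (Fin d), MapMuSet α μ ρ F L δ σ = ∅ := by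
  obtain ⟨s, hs⟩ : ∃ s, Measure.map (α s) μ ≠ μ := by
    by_contra! h
    exact hμ ⟨inferInstance, h⟩
  obtain ⟨g, hg⟩ : ∃ g : C(X, ℝ), ∫ x, g (α s x) ∂μ ≠ ∫ x, g x ∂μ := by
    by_contra! h
    have := Measure.isFiniteMeasure_map μ (α s)
    refine hs (ext_of_forall_integral_eq_of_IsFiniteMeasure fun g => ?_)
    rw [integral_map (hα.cont s).measurable.aemeasurable
      g.continuous.measurable.aestronglyMeasurable]
    exact h g.toContinuousMap
  let g' : C(X, ℝ) := g.comp ⟨α s, hα.cont s⟩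
  set η := |∫ x, g (α s x) ∂μ - ∫ x, g x ∂μ| with hη
  have hηpos : 0 < η := abs_pos.2 (sub_ne_zero.2 hg)
  obtain ⟨δ, hδ, h⟩ := hρ.abs_average_comp_sub_average_lt α s g (by positivity : 0 < η / 3)
  refine ⟨{s}, {g, g'}, min δ (η / 3), by positivity, fun d hd σ =>
    Set.eq_empty_iff_forall_notMem.2 fun φ hφ => ?_⟩
  have h1 := h d hd σ φ (MapSet.mono subset_rfl (min_le_left _ _) hφ.1)
  have h2 := (hφ.2 g (by simp)).trans_le (min_le_right _ _)
  have h3 : |(1 / (d : ℝ)) * ∑ a, g (α s (φ a)) - ∫ x, g (α s x) ∂μ| < η / 3 :=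
    (hφ.2 g' (by simp)).trans_le (min_le_right _ _)
  have : η < η := by
    conv_lhs => rw [hη]
    rw [abs_lt] at *
    constructor <;> linarith
  exact lt_irrefl _ this

theorem exists_card_le_exp (hα : ContAction G X α) (hρ : IsCompatMetric X ρ)
    {d : ℕ → ℕ} {σ : ∀ i, G → Equiv.Perm (Fin (d i))} (hd : Tendsto d atTop atTop)
    (f : C(X, ℝ)) {c : ℝ}
    (hc : ∀ μ : Measure X, IsInvProb α μ →
      MeasEntropy α μ ρ d σ + (((∫ x, f x ∂μ) : ℝ) : EReal) < c)
    {ε : ℝ} (hε : 0 < ε) (μ : Measure X) [IsProbabilityMeasure μ] :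
    ∃ (F : Finset G) (L : Finset C(X, ℝ)) (δ : ℝ), 0 < δ ∧ f ∈ L ∧
      ∀ᶠ i in atTop, ∀ E : Finset (Fin (d i) → X), ↑E ⊆ MapMuSet α μ ρ F L δ (σ i) →
        (∀ φ ∈ E, ∀ ψ ∈ E, φ ≠ ψ → ε ≤ rhoInf ρ φ ψ) →
          (E.card : ℝ) ≤ Real.exp (d i * (c - ∫ x, f x ∂μ - δ)) := by
  by_cases hμ : IsInvProb α μ
  · have hlt : MeasEntropy α μ ρ d σ < ((c - ∫ x, f x ∂μ : ℝ) : EReal) := by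
      rw [EReal.coe_sub]
      exact (EReal.lt_sub_iff_add_lt (.inl (EReal.coe_ne_bot _)) (.inl (EReal.coe_ne_top _))).2
        (hc μ hμ)
    obtain ⟨b, hb, hbc⟩ := EReal.lt_iff_exists_real_btwn.1 hlt
    rw [EReal.coe_lt_coe_iff] at hbc
    obtain ⟨F, L, δ, hδ, h⟩ := exists_card_le_exp_of_measEntropy_lt hρ μ hd hb hε
    refine ⟨F, insert f L, min δ (c - ∫ x, f x ∂μ - b), lt_min hδ (by linarith), by simp, ?_⟩
    filter_upwards [h] with i hi E hE hsep
    refine (hi E (hE.trans (MapMuSet.mono subset_rfl (Finset.subset_insert _ _)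
      (min_le_left _ _))) hsep).trans ?_
    gcongr
    linarith [min_le_right δ (c - ∫ x, f x ∂μ - b)]
  · obtain ⟨F, L, δ, hδ, h⟩ := exists_mapMuSet_eq_empty hα hρ μ hμ
    refine ⟨F, insert f L, δ, hδ, by simp, ?_⟩
    filter_upwards [hd.eventually_gt_atTop 0] with i hi E hE hsep
    have : E = ∅ := by
      have := hE.trans (MapMuSet.mono subset_rfl (Finset.subset_insert _ _) le_rfl)
      rw [h _ hi, Set.subset_empty_iff] at this
      exact_mod_cast this
    simpa [this] using (Real.exp_pos _).le

/-- Compactness of the space of probability measures turns the local bounds of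
`exists_card_le_exp` into a bound on all separated sets of approximately equivariant maps. -/
theorem exists_sum_exp_le (hα : ContAction G X α) (hρ : IsCompatMetric X ρ)
    {d : ℕ → ℕ} {σ : ∀ i, G → Equiv.Perm (Fin (d i))} (hd : Tendsto d atTop atTop)
    (f : C(X, ℝ)) {c : ℝ}
    (hc : ∀ μ : Measure X, IsInvProb α μ →
      MeasEntropy α μ ρ d σ + (((∫ x, f x ∂μ) : ℝ) : EReal) < c)
    {ε : ℝ} (hε : 0 < ε) :
    ∃ (F : Finset G) (δ : ℝ) (K : ℕ), F.Nonempty ∧ 0 < δ ∧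
      ∀ᶠ i in atTop, ∀ E : Finset (Fin (d i) → X), ↑E ⊆ MapSet α ρ F δ (σ i) →
        (∀ φ ∈ E, ∀ ψ ∈ E, φ ≠ ψ → ε ≤ rhoInf ρ φ ψ) →
          ∑ φ ∈ E, Real.exp (∑ a, f (φ a)) ≤ K * Real.exp (d i * c) := by
  choose F L δ hδ hfL hcard using fun μ : ProbabilityMeasure X =>
    exists_card_le_exp hα hρ hd f hc hε (μ : Measure X)
  let U : ProbabilityMeasure X → Set (ProbabilityMeasure X) := fun μ =>
    ⋂ g ∈ L μ, {ν | |∫ x, g x ∂(ν : Measure X) - ∫ x, g x ∂(μ : Measure X)| < δ μ}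
  have hU : ∀ μ, U μ ∈ nhds μ := fun μ => by
    refine (Finset.iInter_mem_sets _).2 fun g _ => IsOpen.mem_nhds ?_ (by simpa using hδ μ)
    have hcont : Continuous fun ν : ProbabilityMeasure X => ∫ x, g x ∂(ν : Measure X) :=
      ProbabilityMeasure.continuous_integral_boundedContinuousFunction
        (BoundedContinuousFunction.mkOfCompact g)
    exact isOpen_lt (hcont.sub continuous_const).abs continuous_const
  obtain ⟨t, ht⟩ := CompactSpace.elim_nhds_subcover U hU
  obtain ⟨δ₀, hδ₀, hδ₀le⟩ : ∃ δ₀ > 0, ∀ μ ∈ t, δ₀ ≤ δ μ := by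
    rcases t.eq_empty_or_nonempty with rfl | hne
    · exact ⟨1, one_pos, by simp⟩
    · obtain ⟨μ, -, hμ⟩ := t.exists_min_image δ hne
      exact ⟨δ μ, hδ μ, hμ⟩
  refine ⟨insert 1 (t.biUnion F), δ₀, t.card, Finset.insert_nonempty _ _, hδ₀, ?_⟩
  filter_upwards [(Filter.eventually_all_finset t).2 fun μ _ => hcard μ,
    hd.eventually_gt_atTop 0] with i hi hdi E hE hsep
  let P : ProbabilityMeasure X → Finset (Fin (d i) → X) := fun μ =>
    E.filter fun φ => φ ∈ MapMuSet α μ ρ (F μ) (L μ) (δ μ) (σ i)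
  have hcover : E ⊆ t.biUnion P := fun φ hφ => by
    let ν : ProbabilityMeasure X :=
      ⟨empiricalMeasure φ, isProbabilityMeasure_empiricalMeasure hdi φ⟩
    have hν : ν ∈ ⋃ μ ∈ t, U μ := by rw [ht]; trivial
    simp only [Set.mem_iUnion] at hν
    obtain ⟨μ, hμ, hνμ⟩ := hν
    refine Finset.mem_biUnion.2 ⟨μ, hμ, Finset.mem_filter.2 ⟨hφ, ?_, fun g hg => ?_⟩⟩
    · exact MapSet.mono ((Finset.subset_biUnion_of_mem F hμ).trans (Finset.subset_insert _ _))
        (hδ₀le μ hμ) (hE hφ)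
    · rw [← integral_empiricalMeasure]
      exact Set.mem_iInter₂.1 hνμ g hg
  calc _ ≤ ∑ φ ∈ t.biUnion P, Real.exp (∑ a, f (φ a)) :=
        Finset.sum_le_sum_of_subset_of_nonneg hcover fun _ _ _ => (Real.exp_pos _).le
    _ ≤ ∑ μ ∈ t, ∑ φ ∈ P μ, Real.exp (∑ a, f (φ a)) :=
        sum_biUnion_le_sum_sum t P fun φ => (Real.exp_pos _).le
    _ ≤ ∑ μ ∈ t, Real.exp (d i * c) := by
        refine Finset.sum_le_sum fun μ hμ => ?_
        have hP : ↑(P μ) ⊆ MapMuSet α μ ρ (F μ) (L μ) (δ μ) (σ i) := fun φ hφ =>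
          (Finset.mem_filter.1 hφ).2
        exact sum_exp_le_exp_of_card_le f hdi (hfL μ) hP (hi μ hμ (P μ) hP fun φ hφ ψ hψ =>
          hsep φ (Finset.filter_subset _ _ hφ) ψ (Finset.filter_subset _ _ hψ))
    _ = _ := by simp

end Measure

theorem log_Mval_le {α : G → X → X} {f : X → ℝ} {ρ : X → X → ℝ} {ε : ℝ} {F : Finset G} {δ : ℝ}
    {d : ℕ} {σ : G → Equiv.Perm (Fin d)} {sepd : (Fin d → X) → (Fin d → X) → ℝ} {B : ℝ}
    (hne : (MapSet α ρ F δ σ).Nonempty)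
    (hB : ∀ E : Finset (Fin d → X), ↑E ⊆ MapSet α ρ F δ σ →
      (∀ φ ∈ E, ∀ ψ ∈ E, φ ≠ ψ → ε ≤ sepd φ ψ) → ∑ φ ∈ E, Real.exp (∑ a, f (φ a)) ≤ B) :
    Real.log (Mval α f ρ ε F δ σ sepd) ≤ Real.log B := by
  obtain ⟨φ, hφ⟩ := hne
  have hub : ∀ r ∈ {r : ℝ | ∃ E : Finset (Fin d → X), ↑E ⊆ MapSet α ρ F δ σ ∧
      (∀ φ ∈ E, ∀ ψ ∈ E, φ ≠ ψ → ε ≤ sepd φ ψ) ∧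
      r = ∑ φ ∈ E, Real.exp (∑ a, f (φ a))}, r ≤ B := by
    rintro r ⟨E, hE, hsep, rfl⟩
    exact hB E hE hsep
  have hmem : Real.exp (∑ a, f (φ a)) ∈ {r : ℝ | ∃ E : Finset (Fin d → X),
      ↑E ⊆ MapSet α ρ F δ σ ∧ (∀ φ ∈ E, ∀ ψ ∈ E, φ ≠ ψ → ε ≤ sepd φ ψ) ∧
      r = ∑ φ ∈ E, Real.exp (∑ a, f (φ a))} :=
    ⟨{φ}, by simpa using hφ, by simp, by simp⟩
  exact Real.log_le_log ((Real.exp_pos _).trans_le (le_csSup ⟨B, hub⟩ hmem))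
    (csSup_le ⟨_, hmem⟩ hub)

end Pressure

theorem stmt3 {G : Type*} [Group G] [Countable G]
    {X : Type*} [TopologicalSpace X] [CompactSpace X] [TopologicalSpace.MetrizableSpace X]
    [MeasurableSpace X] [BorelSpace X]
    (α : G → X → X) (hα : ContAction G X α)
    (d : ℕ → ℕ) (σ : ∀ i, G → Equiv.Perm (Fin (d i))) (hσ : IsSoficApprox G d σ)
    (f : X → ℝ) (hf : Continuous f)
    (ρ : X → X → ℝ) (hρ : IsCompatMetric X ρ) :
    PressureInf α f ρ d σ ≤
      ⨆ (μ : Measure X) (_ : IsInvProb α μ),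
      (MeasEntropy α μ ρ d σ + (((∫ x, f x ∂μ) : ℝ) : EReal)) := by
  have hd := hσ.dim_top
  refine iSup₂_le fun ε hε => le_of_forall_gt fun S' hS' => ?_
  obtain ⟨c, hSc, hcS'⟩ := EReal.lt_iff_exists_real_btwn.1 hS'
  refine lt_of_le_of_lt ?_ hcS'
  obtain ⟨F, δ, K, hF, hδ, h⟩ := exists_sum_exp_le hα hρ hd ⟨f, hf⟩ (c := c)
    (fun μ hμ => (le_iSup₂ (f := fun (μ : Measure X) (_ : IsInvProb α μ) =>
      MeasEntropy α μ ρ d σ + (((∫ x, f x ∂μ) : ℝ) : EReal)) μ hμ).trans_lt hSc) hε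
  refine (iInf₂_le F hF).trans ((iInf₂_le δ hδ).trans ?_)
  refine EReal.le_of_forall_lt_iff_le.1 fun b hb => ?_
  rw [EReal.coe_lt_coe_iff] at hb
  have hK : Tendsto (fun i => Real.log (K + 1) / (d i : ℝ)) atTop (nhds 0) :=
    (tendsto_natCast_atTop_atTop.comp hd).const_div_atTop _
  refine limsup_le_of_le (h := ?_)
  filter_upwards [h, hd.eventually_gt_atTop 0, hK.eventually_lt_const (sub_pos.2 hb)]
    with i hi hdi hKi
  split_ifs with hne
  · have hd' : (0 : ℝ) < d i := by exact_mod_cast hdi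
    have hlog := log_Mval_le (f := f) (B := (K + 1) * Real.exp (d i * c)) hne fun E hE hsep =>
      (hi E hE hsep).trans (by gcongr; linarith)
    rw [Real.log_mul (by positivity) (Real.exp_pos _).ne', Real.log_exp] at hlog
    rw [EReal.coe_le_coe_iff, div_le_iff₀ hd']
    rw [div_lt_iff₀ hd'] at hKi
    linarith
  · exact bot_le

end Sofic
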